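/- If (g, b) satisfies the gain/bias equations for (P, r), then the Cesàro averages of the expected rewards converge to g: the sequence n ↦ (n : ℝ)⁻¹ • ∑_{k=0}^{n-1} (P^k).mulVec r tends to g as n → ∞. (This states that solving the gain/bias equations indeed evaluates the long-run average reward (gain) of the Markov chain, which is the correctness of the strategy-evaluation step of strategy iteration.) -/

import Mathlib

open Matrix Finset

/-- A matrix is row-stochastic if all entries are nonnegative and every row sums to 1. -/
def IsRowStochastic {S : Type*} [Fintype S] (P : Matrix S S ℝ) : Prop :=
  (∀ s s', 0 ≤ P s s') ∧ ∀ s, ∑ s', P s s' = 1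

/-- The gain/bias equations for a transition matrix `P` and reward vector `r`. -/
def GainBiasEq {S : Type*} [Fintype S] (P : Matrix S S ℝ) (r g b : S → ℝ) : Prop :=
  ∀ s, g s = ∑ s', P s s' * g s' ∧ b s = ∑ s', P s s' * b s' + r s - g s

/-- If `(g, b)` satisfies the gain/bias equations for `(P, r)`, then the Cesàro averages of the
expected rewards converge to `g`. -/
theorem gainBias_cesaro_tendsto {S : Type*} [Fintype S] [DecidableEq S] [Nonempty S]
    (P : Matrix S S ℝ) (r g b : S → ℝ) (hP : IsRowStochastic P)
    (h : GainBiasEq P r g b) :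
    Filter.Tendsto (fun n : ℕ => (n : ℝ)⁻¹ • ∑ k ∈ Finset.range n, (P ^ k).mulVec r)
      Filter.atTop (nhds g) := by
  have hg : P.mulVec g = g := by
    funext s; exact (h s).1.symm
  have hr : r = g + b - P.mulVec b := by
    funext s
    have := (h s).2
    simp only [Pi.add_apply, Pi.sub_apply, Matrix.mulVec, dotProduct]
    linarith
  have hpg : ∀ k : ℕ, (P ^ k).mulVec g = g := by
    intro k
    induction k with
    | zero => simp
    | succ k ih => rw [pow_succ, ← Matrix.mulVec_mulVec, hg, ih]
  have hsum : ∀ n : ℕ, ∑ k ∈ Finset.range n, (P ^ k).mulVec r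
      = (n : ℝ) • g + b - (P ^ n).mulVec b := by
    intro n
    induction n with
    | zero => simp
    | succ n ih =>
      have e : (P ^ n).mulVec r = g + (P ^ n).mulVec b - (P ^ (n + 1)).mulVec b := by
        rw [hr, Matrix.mulVec_sub, Matrix.mulVec_add, hpg, Matrix.mulVec_mulVec, ← pow_succ]
      rw [Finset.sum_range_succ, ih, e]
      push_cast
      rw [add_smul, one_smul]
      abel
  have hb : ∀ (n : ℕ) (s : S), |(P ^ n).mulVec b s| ≤ ‖b‖ := by
    intro n
    induction n with
    | zero => intro s; simpa using norm_le_pi_norm b s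
    | succ n ih =>
      intro s
      rw [pow_succ', ← Matrix.mulVec_mulVec]
      calc |P.mulVec ((P ^ n).mulVec b) s|
          ≤ ∑ t, |P s t * (P ^ n).mulVec b t| := Finset.abs_sum_le_sum_abs _ _
        _ ≤ ∑ t, P s t * ‖b‖ := by
            refine Finset.sum_le_sum fun t _ => ?_
            rw [abs_mul, abs_of_nonneg (hP.1 s t)]
            exact mul_le_mul_of_nonneg_left (ih t) (hP.1 s t)
        _ = ‖b‖ := by rw [← Finset.sum_mul, hP.2 s, one_mul]
  have hinv : Filter.Tendsto (fun n : ℕ => (n : ℝ)⁻¹) Filter.atTop (nhds 0) :=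
    tendsto_inv_atTop_nhds_zero_nat
  rw [tendsto_pi_nhds]
  intro s
  have hz : Filter.Tendsto (fun n : ℕ => (n : ℝ)⁻¹ * (b s - (P ^ n).mulVec b s))
      Filter.atTop (nhds 0) := by
    have h2 : Filter.Tendsto (fun n : ℕ => (n : ℝ)⁻¹ * (|b s| + ‖b‖)) Filter.atTop (nhds 0) := by
      simpa using hinv.mul_const (|b s| + ‖b‖)
    refine squeeze_zero_norm (fun n => ?_) h2
    rw [Real.norm_eq_abs, abs_mul, abs_of_nonneg (by positivity : (0 : ℝ) ≤ (n : ℝ)⁻¹)]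
    refine mul_le_mul_of_nonneg_left ?_ (by positivity)
    exact (abs_sub _ _).trans (add_le_add le_rfl (hb n s))
  have h3 := hz.const_add (g s)
  rw [add_zero] at h3
  refine h3.congr' ?_
  filter_upwards [Filter.eventually_gt_atTop 0] with n hn
  have hn' : (n : ℝ) ≠ 0 := by positivity
  rw [hsum]
  simp only [Pi.smul_apply, Pi.add_apply, Pi.sub_apply, smul_eq_mul]
  field_simp
  ring
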